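/- arXiv:1203.3578 — 3 statements merged into one kernel-verified Lean document; each statement's English description precedes it below -/
import Mathlib

section
/- Let V be a finite set, E a nonempty finite set of directed edges on V (parallel edges allowed), B ⊆ V, b : B → ℤ≥0, and let f be an integer-valued intersecting supermodular biset function on V. Let x be an extreme point of P(f,b,E) with 0 < x(e) < 1 for all e ∈ E. Then there exist a laminar biset family L on V and a set C ⊆ B such that |L| + |C| = |E|, x(δ⁻_E(Ŝ)) = f(Ŝ) ≥ 1 for all Ŝ ∈ L, x(δ⁺_E(v)) = b(v) for all v ∈ C, and the incidence vectors in ℝ^E of the edge sets δ⁻_E(Ŝ) for Ŝ ∈ L together with the incidence vectors of the edge sets δ⁺_E(v) for v ∈ C are linearly independent. -/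
noncomputable section

attribute [local instance] Classical.propDecidable

/-- A biset on `V`: an ordered pair of finsets `inner ⊆ outer`. -/
structure Biset (V : Type*) where
  inner : Finset V
  outer : Finset V
  subset : inner ⊆ outer

namespace Biset

variable {V : Type*} [DecidableEq V]

instance [Fintype V] : Fintype (Biset V) :=
  Fintype.ofInjective (fun A => (A.inner, A.outer))
    (fun A B h => by
      cases A; cases B
      simp only [Prod.mk.injEq] at h
      cases h.1; cases h.2; rfl)

/-- The boundary `Γ(Ŝ) = S⁺ ∖ S`. -/
def boundary (A : Biset V) : Finset V := A.outer \ A.inner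

def inter (A B : Biset V) : Biset V :=
  ⟨A.inner ∩ B.inner, A.outer ∩ B.outer, Finset.inter_subset_inter A.subset B.subset⟩

def union (A B : Biset V) : Biset V :=
  ⟨A.inner ∪ B.inner, A.outer ∪ B.outer, Finset.union_subset_union A.subset B.subset⟩

def diff (A B : Biset V) : Biset V :=
  ⟨A.inner \ B.outer, A.outer \ B.inner, Finset.sdiff_subset_sdiff A.subset B.subset⟩

/-- Biset containment: `X̂ ⊆ Ŷ` iff `X ⊆ Y` and `X⁺ ⊆ Y⁺`. -/
def Sub (A B : Biset V) : Prop := A.inner ⊆ B.inner ∧ A.outer ⊆ B.outer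

def Laminar (L : Finset (Biset V)) : Prop :=
  ∀ A ∈ L, ∀ B ∈ L, Sub A B ∨ Sub B A ∨ A.inner ∩ B.inner = ∅

def StronglyLaminar (L : Finset (Biset V)) : Prop :=
  ∀ A ∈ L, ∀ B ∈ L, Sub A B ∨ Sub B A ∨
    (A.inner ∩ B.outer = ∅ ∧ B.inner ∩ A.outer = ∅)

def IntersectingSupermodular (f : Biset V → ℤ) : Prop :=
  ∀ A B : Biset V, (A.inner ∩ B.inner).Nonempty →
    f A + f B ≤ f (inter A B) + f (union A B)

def SkewSupermodular (f : Biset V → ℤ) : Prop :=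
  ∀ A B : Biset V,
    f A + f B ≤ f (inter A B) + f (union A B) ∨
    f A + f B ≤ f (diff A B) + f (diff B A)

def vertexBiset (v : V) : Biset V := ⟨{v}, {v}, Finset.Subset.refl _⟩

end Biset

/-- `γ = max { |Γ(Ŝ)| : f(Ŝ) > 0 }` (0 if no such biset exists). -/
def gammaOf {V : Type*} [Fintype V] [DecidableEq V] (f : Biset V → ℤ) : ℕ :=
  (Finset.univ.filter fun A : Biset V => 0 < f A).sup fun A => (Biset.boundary A).card

/-- The leaves (inclusion-minimal members) of a biset family. -/
def leaves {V : Type*} (L : Finset (Biset V)) : Finset (Biset V) :=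
  L.filter fun A => ∀ B ∈ L, Biset.Sub B A → B = A

/-- `max_{Ŝ ∈ L} |Γ(Ŝ)|` (0 if `L` is empty). -/
def gammaL {V : Type*} [DecidableEq V] (L : Finset (Biset V)) : ℕ :=
  L.sup fun A => (Biset.boundary A).card

section Directed

variable {V E : Type*} [Fintype V] [DecidableEq V] [Fintype E]

/-- `δ⁻_E(Ŝ)`: edges entering the biset (tail outside outer part, head in inner part). -/
def inDelta (tail head : E → V) (A : Biset V) : Finset E :=
  Finset.univ.filter fun e => head e ∈ A.inner ∧ tail e ∉ A.outer

/-- `δ⁺_E(Ŝ)`: edges leaving the biset. -/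
def outDelta (tail head : E → V) (A : Biset V) : Finset E :=
  Finset.univ.filter fun e => tail e ∈ A.inner ∧ head e ∉ A.outer

/-- `δ⁺_E(v)`. -/
def outDeg (tail head : E → V) (v : V) : Finset E :=
  outDelta tail head (Biset.vertexBiset v)

/-- The polytope `P(f,b,E)` for directed edges. -/
def dirP (tail head : E → V) (f : Biset V → ℤ) (B : Finset V) (b : V → ℕ) :
    Set (E → ℝ) :=
  {x | (∀ e : E, 0 ≤ x e ∧ x e ≤ 1) ∧
       (∀ A : Biset V, (f A : ℝ) ≤ ∑ e ∈ inDelta tail head A, x e) ∧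
       (∀ v ∈ B, ∑ e ∈ outDeg tail head v, x e ≤ (b v : ℝ))}

/-- Incidence vector of an edge set. -/
def incVec (F : Finset E) : E → ℝ := fun e => if e ∈ F then 1 else 0

end Directed

namespace Biset

variable {V : Type*} [DecidableEq V]

/-- Two bisets are non-crossing if they are comparable or have disjoint inner parts. -/
def NonCrossing (A B : Biset V) : Prop :=
  Sub A B ∨ Sub B A ∨ A.inner ∩ B.inner = ∅

lemma NonCrossing.symm {A B : Biset V} (h : NonCrossing A B) : NonCrossing B A := by
  rcases h with h | h | h
  · exact Or.inr (Or.inl h)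
  · exact Or.inl h
  · exact Or.inr (Or.inr (by rwa [Finset.inter_comm]))

lemma NonCrossing.refl (A : Biset V) : NonCrossing A A :=
  Or.inl ⟨Finset.Subset.refl _, Finset.Subset.refl _⟩

lemma nonCrossing_inter_self (A B : Biset V) : NonCrossing B (inter A B) :=
  Or.inr (Or.inl ⟨Finset.inter_subset_right, Finset.inter_subset_right⟩)

lemma nonCrossing_union_self (A B : Biset V) : NonCrossing B (union A B) :=
  Or.inl ⟨Finset.subset_union_right, Finset.subset_union_right⟩

lemma NonCrossing.inter {A B C : Biset V} (hA : NonCrossing C A) (hB : NonCrossing C B) :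
    NonCrossing C (inter A B) := by
  rcases hA with ⟨h1, h2⟩ | ⟨h1, h2⟩ | h
  · rcases hB with ⟨h3, h4⟩ | ⟨h3, h4⟩ | h
    · exact Or.inl ⟨Finset.subset_inter h1 h3, Finset.subset_inter h2 h4⟩
    · exact Or.inr (Or.inl ⟨Finset.inter_subset_right.trans h3,
        Finset.inter_subset_right.trans h4⟩)
    · refine Or.inr (Or.inr (Finset.subset_empty.1 ?_))
      exact h ▸ Finset.inter_subset_inter_left Finset.inter_subset_right
  · exact Or.inr (Or.inl ⟨Finset.inter_subset_left.trans h1, Finset.inter_subset_left.trans h2⟩)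
  · refine Or.inr (Or.inr (Finset.subset_empty.1 ?_))
    exact h ▸ Finset.inter_subset_inter_left Finset.inter_subset_left

lemma NonCrossing.union {A B C : Biset V} (hAB : (A.inner ∩ B.inner).Nonempty)
    (hA : NonCrossing C A) (hB : NonCrossing C B) : NonCrossing C (union A B) := by
  obtain ⟨v, hv⟩ := hAB
  rw [Finset.mem_inter] at hv
  rcases hA with ⟨h1, h2⟩ | ⟨h1, h2⟩ | h
  · exact Or.inl ⟨h1.trans Finset.subset_union_left, h2.trans Finset.subset_union_left⟩
  · rcases hB with ⟨h3, h4⟩ | ⟨h3, h4⟩ | h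
    · exact Or.inl ⟨h3.trans Finset.subset_union_right, h4.trans Finset.subset_union_right⟩
    · exact Or.inr (Or.inl ⟨Finset.union_subset h1 h3, Finset.union_subset h2 h4⟩)
    · have : v ∈ C.inner ∩ B.inner := Finset.mem_inter.2 ⟨h1 hv.1, hv.2⟩
      simp [h] at this
  · rcases hB with ⟨h3, h4⟩ | ⟨h3, h4⟩ | h'
    · exact Or.inl ⟨h3.trans Finset.subset_union_right, h4.trans Finset.subset_union_right⟩
    · have : v ∈ C.inner ∩ A.inner := Finset.mem_inter.2 ⟨h3 hv.2, hv.1⟩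
      simp [h] at this
    · refine Or.inr (Or.inr ?_)
      change C.inner ∩ (A.inner ∪ B.inner) = ∅
      rw [Finset.inter_union_distrib_left, h, h', Finset.union_empty]

lemma Laminar.insert {L : Finset (Biset V)} (hL : Laminar L) {A : Biset V}
    (hA : ∀ C ∈ L, NonCrossing C A) : Laminar (insert A L) := by
  intro X hX Y hY
  rcases Finset.mem_insert.1 hX with rfl | hXL <;> rcases Finset.mem_insert.1 hY with rfl | hYL
  · exact NonCrossing.refl _
  · exact (hA Y hYL).symm
  · exact hA X hXL
  · exact hL X hXL Y hYL

/-- If `χ` is additive under uncrossing of intersecting members of `T`, and intersections and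
unions with nonzero image stay in `T`, then some laminar subfamily of `T` spans the image
of `T`. -/
lemma exists_laminar_span {W : Type*} [AddCommGroup W] [Module ℝ W]
    (T : Finset (Biset V)) (χ : Biset V → W)
    (hadd : ∀ A ∈ T, ∀ B ∈ T, (A.inner ∩ B.inner).Nonempty →
      χ A + χ B = χ (inter A B) + χ (union A B))
    (hinter : ∀ A ∈ T, ∀ B ∈ T, (A.inner ∩ B.inner).Nonempty →
      χ (inter A B) ≠ 0 → inter A B ∈ T)
    (hunion : ∀ A ∈ T, ∀ B ∈ T, (A.inner ∩ B.inner).Nonempty →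
      χ (union A B) ≠ 0 → union A B ∈ T) :
    ∃ L ⊆ T, Laminar L ∧ ∀ A ∈ T, χ A ∈ Submodule.span ℝ (χ '' (L : Set (Biset V))) := by
  obtain ⟨L, hLmem, hLmax⟩ := Finset.exists_max_image (T.powerset.filter Laminar) Finset.card
    ⟨∅, by simp [Laminar]⟩
  simp only [Finset.mem_filter, Finset.mem_powerset] at hLmem hLmax
  obtain ⟨hLT, hL⟩ := hLmem
  refine ⟨L, hLT, hL, ?_⟩
  by_contra! hex
  obtain ⟨A₀, hA₀T, hA₀⟩ := hex
  obtain ⟨A, hA, hmin⟩ := Finset.exists_min_image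
    (T.filter fun A => χ A ∉ Submodule.span ℝ (χ '' (L : Set (Biset V))))
    (fun A => (L.filter fun C => ¬ NonCrossing C A).card)
    ⟨A₀, Finset.mem_filter.2 ⟨hA₀T, hA₀⟩⟩
  simp only [Finset.mem_filter] at hA hmin
  obtain ⟨hAT, hAs⟩ := hA
  by_cases hcross : ∀ C ∈ L, NonCrossing C A
  · have hAL : A ∉ L := fun h => hAs (Submodule.subset_span ⟨A, h, rfl⟩)
    have := hLmax (Insert.insert A L) ⟨Finset.insert_subset hAT hLT, hL.insert hcross⟩
    rw [Finset.card_insert_of_notMem hAL] at this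
    omega
  push Not at hcross
  obtain ⟨B, hBL, hBA⟩ := hcross
  have hAB : (A.inner ∩ B.inner).Nonempty := by
    rw [Finset.nonempty_iff_ne_empty, Finset.inter_comm]
    exact fun h => hBA (Or.inr (Or.inr h))
  have hBT := hLT hBL
  have contra : ∀ D : Biset V, NonCrossing B D →
      (∀ C ∈ L, NonCrossing C A → NonCrossing C D) → (χ D ≠ 0 → D ∈ T) →
      χ D ∈ Submodule.span ℝ (χ '' (L : Set (Biset V))) := by
    intro D hBD hD hDT
    by_contra hDs
    have hle := hmin D ⟨hDT fun h => hDs (h ▸ Submodule.zero_mem _), hDs⟩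
    refine absurd hle (not_le.2 (Finset.card_lt_card ?_))
    refine Finset.ssubset_iff_of_subset (fun C hC => ?_) |>.2
      ⟨B, by simp [hBL, hBA], by simp [hBD]⟩
    simp only [Finset.mem_filter] at hC ⊢
    exact ⟨hC.1, fun h => hC.2 (hD C hC.1 h)⟩
  have h1 := contra (inter A B) (nonCrossing_inter_self A B)
    (fun C hC h => h.inter (hL C hC B hBL)) (hinter A hAT B hBT hAB)
  have h2 := contra (union A B) (nonCrossing_union_self A B)
    (fun C hC h => h.union hAB (hL C hC B hBL)) (hunion A hAT B hBT hAB)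
  apply hAs
  rw [eq_sub_of_add_eq (hadd A hAT B hBT hAB)]
  exact Submodule.sub_mem _ (Submodule.add_mem _ h1 h2) (Submodule.subset_span ⟨B, hBL, rfl⟩)

end Biset

section Polytope

lemma eq_empty_of_sum_nonpos {E : Type*} {x : E → ℝ} (hpos : ∀ e, 0 < x e) {F : Finset E}
    (h : ∑ e ∈ F, x e ≤ 0) : F = ∅ := by
  by_contra hne
  exact absurd h (not_le.2 (Finset.sum_pos (fun e _ => hpos e)
    (Finset.nonempty_iff_ne_empty.2 hne)))

variable {V E : Type*} [DecidableEq V] [Fintype E]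

lemma sum_incVec_mul (F : Finset E) (z : E → ℝ) : ∑ e, incVec F e * z e = ∑ e ∈ F, z e := by
  simp [incVec, Finset.sum_ite_mem]

lemma incVec_inter_add_union_le (tail head : E → V) (A B : Biset V) (e : E) :
    incVec (inDelta tail head (Biset.inter A B)) e +
      incVec (inDelta tail head (Biset.union A B)) e ≤
    incVec (inDelta tail head A) e + incVec (inDelta tail head B) e := by
  by_cases h1 : head e ∈ A.inner <;> by_cases h2 : head e ∈ B.inner <;>
    by_cases h3 : tail e ∈ A.outer <;> by_cases h4 : tail e ∈ B.outer <;>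
    simp [incVec, inDelta, Biset.inter, Biset.union, h1, h2, h3, h4]

/-- Uncrossing tight bisets at a positive point. -/
lemma uncross_tight {tail head : E → V} {f : Biset V → ℤ}
    (hf : Biset.IntersectingSupermodular f) {x : E → ℝ} (hpos : ∀ e, 0 < x e)
    (hx : ∀ A : Biset V, (f A : ℝ) ≤ ∑ e ∈ inDelta tail head A, x e) {A B : Biset V}
    (hA : ∑ e ∈ inDelta tail head A, x e = f A) (hB : ∑ e ∈ inDelta tail head B, x e = f B)
    (hAB : (A.inner ∩ B.inner).Nonempty) :
    ∑ e ∈ inDelta tail head (Biset.inter A B), x e = f (Biset.inter A B) ∧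
    ∑ e ∈ inDelta tail head (Biset.union A B), x e = f (Biset.union A B) ∧
    incVec (inDelta tail head A) + incVec (inDelta tail head B) =
      incVec (inDelta tail head (Biset.inter A B)) +
      incVec (inDelta tail head (Biset.union A B)) := by
  have hsuper : (f A : ℝ) + f B ≤ f (Biset.inter A B) + f (Biset.union A B) := by
    exact_mod_cast hf A B hAB
  have hI := hx (Biset.inter A B)
  have hU := hx (Biset.union A B)
  have hnonneg : ∀ e ∈ Finset.univ, 0 ≤
      (incVec (inDelta tail head A) e + incVec (inDelta tail head B) e -
      (incVec (inDelta tail head (Biset.inter A B)) e +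
      incVec (inDelta tail head (Biset.union A B)) e)) * x e := fun e _ =>
    mul_nonneg (sub_nonneg.2 (incVec_inter_add_union_le tail head A B e)) (hpos e).le
  have hsum := Finset.sum_nonneg hnonneg
  have heq := Finset.sum_eq_zero_iff_of_nonneg hnonneg
  simp only [sub_mul, add_mul, Finset.sum_sub_distrib, Finset.sum_add_distrib, sum_incVec_mul]
    at hsum heq
  refine ⟨by linarith, by linarith, funext fun e => ?_⟩
  have h0 := heq.1 (by linarith) e (Finset.mem_univ e)
  have hfac : (incVec (inDelta tail head A) e + incVec (inDelta tail head B) e -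
      (incVec (inDelta tail head (Biset.inter A B)) e +
      incVec (inDelta tail head (Biset.union A B)) e)) * x e = 0 := by
    linarith
  exact sub_eq_zero.1 ((mul_eq_zero.1 hfac).resolve_right (hpos e).ne')

/-- A direction orthogonal to all tight constraints at an interior extreme point vanishes. -/
lemma eq_zero_of_orthogonal_tight [Fintype V] {tail head : E → V} {f : Biset V → ℤ} {B : Finset V}
    {b : V → ℕ} {x : E → ℝ} (hx : x ∈ Set.extremePoints ℝ (dirP tail head f B b))
    (hx01 : ∀ e : E, 0 < x e ∧ x e < 1) (y : E → ℝ)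
    (hin : ∀ A, ∑ e ∈ inDelta tail head A, x e = f A → 1 ≤ f A →
      ∑ e ∈ inDelta tail head A, y e = 0)
    (hout : ∀ v ∈ B, ∑ e ∈ outDeg tail head v, x e = b v →
      ∑ e ∈ outDeg tail head v, y e = 0) : y = 0 := by
  obtain ⟨⟨-, hxin, hxout⟩, hext⟩ := mem_extremePoints.1 hx
  have hlim : ∀ F : Finset E, Filter.Tendsto (fun t : ℝ => ∑ e ∈ F, (x + t • y) e)
      (nhds 0) (nhds (∑ e ∈ F, x e)) := by
    intro F
    have : Continuous fun t : ℝ => ∑ e ∈ F, (x + t • y) e := by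
      simp only [Pi.add_apply, Pi.smul_apply, smul_eq_mul]
      fun_prop
    simpa using this.tendsto 0
  have hconst : ∀ (F : Finset E) (t : ℝ), ∑ e ∈ F, y e = 0 →
      ∑ e ∈ F, (x + t • y) e = ∑ e ∈ F, x e := by
    intro F t h
    simp [Finset.sum_add_distrib, ← Finset.mul_sum, h]
  have hev : ∀ᶠ t : ℝ in nhds 0, x + t • y ∈ dirP tail head f B b := by
    refine Filter.Eventually.and ?_ (Filter.Eventually.and ?_ ?_)
    · refine Filter.eventually_all.2 fun e => ?_
      have h := hlim {e}
      simp only [Finset.sum_singleton] at h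
      exact (h.eventually (lt_mem_nhds (hx01 e).1)).mp
        ((h.eventually (gt_mem_nhds (hx01 e).2)).mono fun t h1 h0 => ⟨h0.le, h1.le⟩)
    · refine Filter.eventually_all.2 fun A => ?_
      rcases (hxin A).lt_or_eq with hlt | heq
      · exact ((hlim _).eventually (lt_mem_nhds hlt)).mono fun t h => h.le
      · refine Filter.Eventually.of_forall fun t => ?_
        have hy : ∑ e ∈ inDelta tail head A, y e = 0 := by
          by_cases hfA : 1 ≤ f A
          · exact hin A heq.symm hfA
          · have hle : (f A : ℝ) ≤ 0 := by exact_mod_cast (by omega : f A ≤ 0)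
            rw [eq_empty_of_sum_nonpos (fun e => (hx01 e).1) (heq.symm.trans_le hle)]
            simp
        rw [hconst _ t hy]
        exact heq.le
    · refine (Filter.eventually_all_finset B).2 fun v hv => ?_
      rcases (hxout v hv).lt_or_eq with hlt | heq
      · exact ((hlim _).eventually (gt_mem_nhds hlt)).mono fun t h => h.le
      · refine Filter.Eventually.of_forall fun t => ?_
        rw [hconst _ t (hout v hv heq)]
        exact heq.le
  have hneg : ∀ᶠ t : ℝ in nhds 0, x + (-t) • y ∈ dirP tail head f B b := by
    have : Filter.Tendsto (fun t : ℝ => -t) (nhds 0) (nhds 0) := by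
      simpa using (continuous_neg (G := ℝ)).tendsto 0
    exact this.eventually hev
  obtain ⟨ε, hε, hε'⟩ := Metric.eventually_nhds_iff.1 (hev.and hneg)
  have hhalf : 0 < ε / 2 := by positivity
  obtain ⟨h1, h2⟩ := @hε' (ε / 2) (by
    rw [Real.dist_eq, sub_zero, abs_of_pos hhalf]
    linarith)
  have hseg : x ∈ openSegment ℝ (x + (ε / 2) • y) (x + (-(ε / 2)) • y) := by
    refine ⟨1 / 2, 1 / 2, by norm_num, by norm_num, by norm_num, ?_⟩
    module
  have hxy := (hext _ h1 _ h2 hseg).1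
  exact (smul_eq_zero.1 (by simpa using hxy)).resolve_left hhalf.ne'

/-- The tight constraints at an interior extreme point span the whole space. -/
lemma span_tight_eq_top [Fintype V] {tail head : E → V} {f : Biset V → ℤ} {B : Finset V}
    {b : V → ℕ} {x : E → ℝ} (hx : x ∈ Set.extremePoints ℝ (dirP tail head f B b))
    (hx01 : ∀ e : E, 0 < x e ∧ x e < 1) (W : Submodule ℝ (E → ℝ))
    (hin : ∀ A, ∑ e ∈ inDelta tail head A, x e = f A → 1 ≤ f A →
      incVec (inDelta tail head A) ∈ W)
    (hout : ∀ v ∈ B, ∑ e ∈ outDeg tail head v, x e = b v →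
      incVec (outDeg tail head v) ∈ W) : W = ⊤ := by
  by_contra hW
  obtain ⟨φ, hφ, hker⟩ := Submodule.exists_le_ker_of_lt_top W (lt_top_iff_ne_top.2 hW)
  have hφsum : ∀ F : Finset E, incVec F ∈ W →
      ∑ e ∈ F, φ (Pi.single e 1) = 0 := by
    intro F hF
    have h := LinearMap.mem_ker.1 (hker hF)
    rw [← sum_incVec_mul, ← h, pi_eq_sum_univ' (incVec F), map_sum]
    simp [Pi.single_apply, map_smul]
  have hy := eq_zero_of_orthogonal_tight hx hx01 (fun e => φ (Pi.single e 1))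
    (fun A h1 h2 => hφsum _ (hin A h1 h2)) (fun v hv h => hφsum _ (hout v hv h))
  refine hφ (LinearMap.pi_ext' fun e => LinearMap.ext_ring ?_)
  simpa using congrFun hy e

end Polytope

theorem stmt_3 {V E : Type*} [Fintype V] [DecidableEq V] [Fintype E] [Nonempty E]
    (tail head : E → V) (B : Finset V) (b : V → ℕ)
    (f : Biset V → ℤ) (hf : Biset.IntersectingSupermodular f)
    (x : E → ℝ) (hx : x ∈ Set.extremePoints ℝ (dirP tail head f B b))
    (hx01 : ∀ e : E, 0 < x e ∧ x e < 1) :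
    ∃ (L : Finset (Biset V)) (C : Finset V),
      Biset.Laminar L ∧ C ⊆ B ∧ L.card + C.card = Fintype.card E ∧
      (∀ A ∈ L, (∑ e ∈ inDelta tail head A, x e) = (f A : ℝ) ∧ 1 ≤ f A) ∧
      (∀ v ∈ C, (∑ e ∈ outDeg tail head v, x e) = (b v : ℝ)) ∧
      LinearIndependent ℝ (Sum.elim
        (fun A : {A // A ∈ L} => incVec (inDelta tail head A.1))
        (fun v : {v // v ∈ C} => incVec (outDeg tail head v.1))) := by
  obtain ⟨-, hxin, -⟩ := hx.1
  have hpos : ∀ e, 0 < x e := fun e => (hx01 e).1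
  have hmem : ∀ D : Biset V, ∑ e ∈ inDelta tail head D, x e = f D →
      incVec (inDelta tail head D) ≠ 0 →
      D ∈ Finset.univ.filter fun A : Biset V =>
        ∑ e ∈ inDelta tail head A, x e = f A ∧ 1 ≤ f A := by
    intro D hD hne
    refine Finset.mem_filter.2 ⟨Finset.mem_univ _, hD, ?_⟩
    by_contra hfD
    have hle : (f D : ℝ) ≤ 0 := by exact_mod_cast (by omega : f D ≤ 0)
    apply hne
    rw [eq_empty_of_sum_nonpos hpos (hD.trans_le hle)]
    ext e
    simp [incVec]
  obtain ⟨L₀, hL₀T, hL₀, hspan⟩ := Biset.exists_laminar_span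
    (Finset.univ.filter fun A : Biset V => ∑ e ∈ inDelta tail head A, x e = f A ∧ 1 ≤ f A)
    (fun A => incVec (inDelta tail head A))
    (fun A hA B hB hAB => (uncross_tight hf hpos hxin (Finset.mem_filter.1 hA).2.1
      (Finset.mem_filter.1 hB).2.1 hAB).2.2)
    (fun A hA B hB hAB => hmem _ (uncross_tight hf hpos hxin (Finset.mem_filter.1 hA).2.1
      (Finset.mem_filter.1 hB).2.1 hAB).1)
    (fun A hA B hB hAB => hmem _ (uncross_tight hf hpos hxin (Finset.mem_filter.1 hA).2.1
      (Finset.mem_filter.1 hB).2.1 hAB).2.1)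
  let vec : Biset V ⊕ V → E → ℝ :=
    Sum.elim (fun A => incVec (inDelta tail head A)) (fun v => incVec (outDeg tail head v))
  let I : Set (Biset V ⊕ V) := {i | Sum.elim (fun A => A ∈ L₀)
    (fun v => v ∈ B ∧ ∑ e ∈ outDeg tail head v, x e = b v) i}
  obtain ⟨J, hJI, -, hIJ, hJ⟩ :=
    exists_linearIndepOn_extension (linearIndepOn_empty ℝ vec) (Set.empty_subset I)
  have htop : Submodule.span ℝ (vec '' J) = ⊤ := by
    refine span_tight_eq_top hx hx01 _ (fun A h1 h2 => ?_) (fun v hv h => ?_)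
    · refine Submodule.span_le.2 ?_ (hspan A (by simp [h1, h2]))
      rintro _ ⟨A, hA, rfl⟩
      exact hIJ ⟨Sum.inl A, hA, rfl⟩
    · exact hIJ ⟨Sum.inr v, ⟨hv, h⟩, rfl⟩
  let L : Finset (Biset V) := Finset.univ.filter fun A => Sum.inl A ∈ J
  let C : Finset V := Finset.univ.filter fun v => Sum.inr v ∈ J
  have hLL₀ : L ⊆ L₀ := fun A hA => hJI (Finset.mem_filter.1 hA).2
  have hC : ∀ v ∈ C, v ∈ B ∧ ∑ e ∈ outDeg tail head v, x e = b v :=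
    fun v hv => hJI (Finset.mem_filter.1 hv).2
  let g : {A // A ∈ L} ⊕ {v // v ∈ C} → J :=
    Sum.elim (fun A => ⟨Sum.inl A.1, (Finset.mem_filter.1 A.2).2⟩)
      (fun v => ⟨Sum.inr v.1, (Finset.mem_filter.1 v.2).2⟩)
  have hg : Function.Injective g := by
    rintro (⟨A, hA⟩ | ⟨v, hv⟩) (⟨A', hA'⟩ | ⟨v', hv'⟩) h <;> simp [g] at h ⊢ <;> exact h
  have hli : LinearIndependent ℝ (Sum.elim
      (fun A : {A // A ∈ L} => incVec (inDelta tail head A.1))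
      (fun v : {v // v ∈ C} => incVec (outDeg tail head v.1))) := by
    have hcomp := LinearIndependent.comp hJ g hg
    have heq : (fun i : J => vec i) ∘ g = Sum.elim
        (fun A : {A // A ∈ L} => incVec (inDelta tail head A.1))
        (fun v : {v // v ∈ C} => incVec (outDeg tail head v.1)) := by
      ext (A | v) <;> rfl
    rwa [heq] at hcomp
  refine ⟨L, C, fun A hA A' hA' => hL₀ A (hLL₀ hA) A' (hLL₀ hA'), fun v hv => (hC v hv).1, ?_,
    fun A hA => (Finset.mem_filter.1 (hL₀T (hLL₀ hA))).2, fun v hv => (hC v hv).2, hli⟩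
  have hcard := Module.finrank_eq_card_basis (Module.Basis.mk hli (by
    rw [← htop]
    refine Submodule.span_mono ?_
    rintro _ ⟨A | v, hJ, rfl⟩
    · exact ⟨Sum.inl ⟨A, by simp [L, hJ]⟩, rfl⟩
    · exact ⟨Sum.inr ⟨v, by simp [C, hJ]⟩, rfl⟩))
  simpa using hcard.symm
end
end

section
/- Let V be a finite set, E a nonempty finite set of directed edges on V, B ⊆ V, b : B → ℤ≥0, f an integer-valued biset function on V, and α ≥ 2 an integer. Let x ∈ P(f,b,E) with 0 < x(e) < 1 for all e ∈ E, and suppose there exist a laminar biset family L on V and C ⊆ B such that |L| + |C| = |E|, x(δ⁻_E(Ŝ)) = f(Ŝ) ≥ 1 for all Ŝ ∈ L, x(δ⁺_E(v)) = b(v) for all v ∈ C, and the incidence vectors in ℝ^E of the sets δ⁻_E(Ŝ) for Ŝ ∈ L together with those of δ⁺_E(v) for v ∈ C are linearly independent. Let 𝓔 be the set of leaves of L. If (α−1)|𝓔| ≥ |C|, then there is an edge e ∈ E with x(e) ≥ 1/α. -/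
noncomputable section

attribute [local instance] Classical.propDecidable

instance Biset.instPartialOrder {V : Type*} : PartialOrder (Biset V) where
  le := Biset.Sub
  le_refl A := ⟨subset_rfl, subset_rfl⟩
  le_trans _ _ _ h k := ⟨h.1.trans k.1, h.2.trans k.2⟩
  le_antisymm A B h k := by
    cases A
    cases B
    simp only [Biset.mk.injEq]
    exact ⟨h.1.antisymm k.1, h.2.antisymm k.2⟩

/-- The children of `A` in `L`: the maximal members of `L` strictly below `A`. -/
def Biset.children {V : Type*} (L : Finset (Biset V)) (A : Biset V) : Finset (Biset V) :=
  L.filter fun R => Maximal (fun Q => Q ∈ L ∧ Q < A) R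

theorem mem_leaves {V : Type*} {L : Finset (Biset V)} {A : Biset V} :
    A ∈ leaves L ↔ A ∈ L ∧ ∀ B ∈ L, Biset.Sub B A → B = A := by
  simp [leaves]

theorem leaves_subset {V : Type*} (L : Finset (Biset V)) : leaves L ⊆ L :=
  fun _ hA => (mem_leaves.1 hA).1

theorem Biset.mem_children {V : Type*} {L : Finset (Biset V)} {A R : Biset V} :
    R ∈ Biset.children L A ↔ Maximal (fun Q => Q ∈ L ∧ Q < A) R := by
  simp only [Biset.children, Finset.mem_filter, and_iff_right_iff_imp]
  exact fun h => h.prop.1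

theorem children_eq_empty_of_mem_leaves {V : Type*} {L : Finset (Biset V)} {A : Biset V}
    (hA : A ∈ leaves L) : Biset.children L A = ∅ := by
  refine Finset.eq_empty_of_forall_notMem fun R hR => ?_
  have hR' := (Biset.mem_children.1 hR).prop
  exact hR'.2.ne ((mem_leaves.1 hA).2 R hR'.1 hR'.2.le)

theorem Biset.exists_children_ge {V : Type*} {L : Finset (Biset V)} {A S : Biset V}
    (hS : S ∈ L) (hSA : S < A) : ∃ R ∈ Biset.children L A, S ≤ R := by
  obtain ⟨R, hSR, hR⟩ := (L.filter (· < A)).exists_le_maximal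
    (Finset.mem_filter.2 ⟨hS, hSA⟩)
  refine ⟨R, Biset.mem_children.2 ?_, hSR⟩
  simpa only [Finset.mem_filter] using hR

theorem Biset.Laminar.le_or_le {V : Type*} [DecidableEq V] {L : Finset (Biset V)}
    {R S : Biset V} (hlam : Biset.Laminar L) (hS : S ∈ L) (hR : R ∈ L) {v : V}
    (hvS : v ∈ S.inner) (hvR : v ∈ R.inner) : S ≤ R ∨ R ≤ S := by
  rcases hlam S hS R hR with h | h | h
  · exact Or.inl h
  · exact Or.inr h
  · exact absurd (h ▸ Finset.mem_inter.2 ⟨hvS, hvR⟩) (Finset.notMem_empty v)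

section Entering

variable {V E : Type*} [DecidableEq V] [Fintype E] {L : Finset (Biset V)} {tail head : E → V}

theorem mem_inDelta {A : Biset V} {e : E} :
    e ∈ inDelta tail head A ↔ head e ∈ A.inner ∧ tail e ∉ A.outer := by
  simp [inDelta]

/-- The edges entering some child of `A`. -/
def childDelta (tail head : E → V) (L : Finset (Biset V)) (A : Biset V) : Finset E :=
  (Biset.children L A).biUnion (inDelta tail head)

theorem mem_childDelta {A : Biset V} {e : E} :
    e ∈ childDelta tail head L A ↔ ∃ R ∈ Biset.children L A, e ∈ inDelta tail head R := by
  simp [childDelta]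

theorem Biset.Laminar.pairwiseDisjoint_children (hlam : Biset.Laminar L) (A : Biset V) :
    (Biset.children L A : Set (Biset V)).PairwiseDisjoint (inDelta tail head) := by
  intro R hR S hS hne
  refine Finset.disjoint_left.2 fun e heR heS => hne ?_
  rw [Finset.mem_coe, Biset.mem_children] at hR hS
  rcases hlam.le_or_le hR.prop.1 hS.prop.1 (mem_inDelta.1 heR).1 (mem_inDelta.1 heS).1 with h | h
  · exact hR.eq_of_le hS.prop h
  · exact (hS.eq_of_le hR.prop h).symm

theorem mem_childDelta_of_lt {S A : Biset V} (hS : S ∈ L) (hSA : S < A) {e : E}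
    (heS : head e ∈ S.inner) (heA : e ∈ inDelta tail head A) :
    e ∈ childDelta tail head L A := by
  obtain ⟨R, hR, hSR⟩ := Biset.exists_children_ge hS hSA
  refine mem_childDelta.2 ⟨R, hR, mem_inDelta.2 ⟨hSR.1 heS, fun h => (mem_inDelta.1 heA).2 ?_⟩⟩
  exact (Biset.mem_children.1 hR).prop.2.le.2 h

theorem Biset.Laminar.eq_of_mem_inDelta_sdiff (hlam : Biset.Laminar L) {A S : Biset V}
    (hA : A ∈ L) (hS : S ∈ L) {e : E}
    (heA : e ∈ inDelta tail head A \ childDelta tail head L A)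
    (heS : e ∈ inDelta tail head S \ childDelta tail head L S) : A = S := by
  rw [Finset.mem_sdiff] at heA heS
  by_contra hne
  have hA1 := (mem_inDelta.1 heA.1).1
  have hS1 := (mem_inDelta.1 heS.1).1
  rcases hlam.le_or_le hA hS hA1 hS1 with h | h
  · exact heS.2 (mem_childDelta_of_lt hA (lt_of_le_of_ne h hne) hA1 heS.1)
  · exact heA.2 (mem_childDelta_of_lt hS (lt_of_le_of_ne h (Ne.symm hne)) hS1 heA.1)

theorem head_mem_and_tail_mem_of_mem_childDelta_sdiff {A : Biset V} {e : E}
    (he : e ∈ childDelta tail head L A \ inDelta tail head A) :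
    head e ∈ A.inner ∧ tail e ∈ A.outer := by
  rw [Finset.mem_sdiff, mem_childDelta] at he
  obtain ⟨⟨R, hR, heR⟩, heA⟩ := he
  have hh : head e ∈ A.inner :=
    (Biset.mem_children.1 hR).prop.2.le.1 (mem_inDelta.1 heR).1
  exact ⟨hh, by_contra fun ht => heA (mem_inDelta.2 ⟨hh, ht⟩)⟩

theorem Biset.Laminar.not_lt_of_mem_childDelta_sdiff (hlam : Biset.Laminar L) {A S : Biset V}
    (hA : A ∈ L) {e : E}
    (heA : e ∈ childDelta tail head L A \ inDelta tail head A)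
    (heS : e ∈ childDelta tail head L S \ inDelta tail head S) : ¬ A < S := by
  intro hlt
  obtain ⟨hh, ht⟩ := head_mem_and_tail_mem_of_mem_childDelta_sdiff heA
  obtain ⟨R, hR, heR⟩ := mem_childDelta.1 (Finset.mem_sdiff.1 heS).1
  rw [Biset.mem_children] at hR
  rw [mem_inDelta] at heR
  rcases hlam.le_or_le hA hR.prop.1 hh heR.1 with h | h
  · exact heR.2 (h.2 ht)
  · have := hR.eq_of_le ⟨hA, hlt⟩ h
    subst this
    exact heR.2 ht

theorem Biset.Laminar.eq_of_mem_childDelta_sdiff (hlam : Biset.Laminar L) {A S : Biset V}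
    (hA : A ∈ L) (hS : S ∈ L) {e : E}
    (heA : e ∈ childDelta tail head L A \ inDelta tail head A)
    (heS : e ∈ childDelta tail head L S \ inDelta tail head S) : A = S := by
  by_contra hne
  rcases hlam.le_or_le hA hS (head_mem_and_tail_mem_of_mem_childDelta_sdiff heA).1
    (head_mem_and_tail_mem_of_mem_childDelta_sdiff heS).1 with h | h
  · exact hlam.not_lt_of_mem_childDelta_sdiff hA heA heS (lt_of_le_of_ne h hne)
  · exact hlam.not_lt_of_mem_childDelta_sdiff hS heS heA (lt_of_le_of_ne h (Ne.symm hne))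

theorem Biset.Laminar.notMem_childDelta_sdiff_of_maximal (hlam : Biset.Laminar L)
    {M A : Biset V} (hM : Maximal (· ∈ L) M) (hA : A ∈ L) {e : E}
    (he : e ∈ inDelta tail head M) : e ∉ childDelta tail head L A \ inDelta tail head A := by
  intro heA
  obtain ⟨hh, ht⟩ := head_mem_and_tail_mem_of_mem_childDelta_sdiff heA
  rw [mem_inDelta] at he
  rcases hlam.le_or_le hA hM.prop hh he.1 with h | h
  · exact he.2 (h.2 ht)
  · have := hM.eq_of_le hA h
    subst this
    exact he.2 ht

theorem Biset.Laminar.inDelta_ne_childDelta (hlam : Biset.Laminar L)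
    (hind : LinearIndependent ℝ fun A : {A // A ∈ L} => incVec (inDelta tail head A.1))
    {A : Biset V} (hA : A ∈ L) : inDelta tail head A ≠ childDelta tail head L A := by
  intro heq
  refine hind.notMem_span_image (s := {⟨A, hA⟩}ᶜ) (x := ⟨A, hA⟩) (by simp) ?_
  have hsum : incVec (inDelta tail head A) =
      ∑ R ∈ Biset.children L A, incVec (inDelta tail head R) := by
    funext e
    have h := Finset.sum_biUnion (f := fun e' => if e' = e then (1 : ℝ) else 0)
      (hlam.pairwiseDisjoint_children (tail := tail) (head := head) A)
    change ∑ e' ∈ childDelta tail head L A, _ = _ at h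
    rw [← heq] at h
    simpa [incVec, Finset.sum_apply] using h
  show incVec (inDelta tail head A) ∈ _
  rw [hsum]
  refine Submodule.sum_mem _ fun R hR => Submodule.subset_span ?_
  have hR' := (Biset.mem_children.1 hR).prop
  refine ⟨⟨R, hR'.1⟩, ?_, rfl⟩
  simpa using hR'.2.ne

/-- The tokens collected by `A`: an edge `e` gives `y e` to the smallest biset it enters, and
`1 - y e` to the first biset containing its head that it does not enter. -/
def tokens (tail head : E → V) (L : Finset (Biset V)) (y : E → ℝ) (A : Biset V) : ℝ :=
  ∑ e ∈ inDelta tail head A \ childDelta tail head L A, y e +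
    ∑ e ∈ childDelta tail head L A \ inDelta tail head A, (1 - y e)

theorem Biset.Laminar.tokens_eq (hlam : Biset.Laminar L) (y : E → ℝ) (A : Biset V) :
    tokens tail head L y A = ∑ e ∈ inDelta tail head A, y e
      - ∑ R ∈ Biset.children L A, ∑ e ∈ inDelta tail head R, y e
      + (childDelta tail head L A \ inDelta tail head A).card := by
  rw [← Finset.sum_biUnion (hlam.pairwiseDisjoint_children (tail := tail) (head := head) A)]
  change _ = _ - ∑ e ∈ childDelta tail head L A, y e + _
  have h := Finset.sum_sdiff_sub_sum_sdiff (s₁ := childDelta tail head L A)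
    (s₂ := inDelta tail head A) (f := y)
  simp only [tokens, Finset.sum_sub_distrib, Finset.sum_const, nsmul_eq_mul, mul_one]
  linarith

theorem tokens_pos {y : E → ℝ} (hy0 : ∀ e, 0 < y e) (hy1 : ∀ e, y e < 1) {A : Biset V}
    (hA : inDelta tail head A ≠ childDelta tail head L A) : 0 < tokens tail head L y A := by
  have h1 : ∀ e ∈ inDelta tail head A \ childDelta tail head L A, 0 < y e := fun e _ => hy0 e
  have h2 : ∀ e ∈ childDelta tail head L A \ inDelta tail head A, 0 < 1 - y e :=
    fun e _ => sub_pos.2 (hy1 e)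
  rcases (inDelta tail head A \ childDelta tail head L A).eq_empty_or_nonempty with h | h
  · rcases (childDelta tail head L A \ inDelta tail head A).eq_empty_or_nonempty with h' | h'
    · exact absurd ((Finset.sdiff_eq_empty_iff_subset.1 h).antisymm
        (Finset.sdiff_eq_empty_iff_subset.1 h')) hA
    · exact add_pos_of_nonneg_of_pos (Finset.sum_nonneg fun e he => (h1 e he).le)
        (Finset.sum_pos h2 h')
  · exact add_pos_of_pos_of_nonneg (Finset.sum_pos h1 h)
      (Finset.sum_nonneg fun e he => (h2 e he).le)

theorem Finset.sum_sum_eq_sum_biUnion_of_unique {ι E : Type*} (L : Finset ι) (F : ι → Finset E)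
    (hF : ∀ A ∈ L, ∀ S ∈ L, ∀ e, e ∈ F A → e ∈ F S → A = S) (g : E → ℝ) :
    ∑ A ∈ L, ∑ e ∈ F A, g e = ∑ e ∈ L.biUnion F, g e :=
  (Finset.sum_biUnion fun A hA S hS hne =>
    Finset.disjoint_left.2 fun e h h' => hne (hF A hA S hS e h h')).symm

theorem Biset.Laminar.sum_tokens_lt (hlam : Biset.Laminar L) {y : E → ℝ}
    (hy0 : ∀ e, 0 < y e) (hy1 : ∀ e, y e < 1) (hL : L.Nonempty)
    (hne : ∀ A ∈ L, (inDelta tail head A).Nonempty) :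
    ∑ A ∈ L, tokens tail head L y A < Fintype.card E := by
  simp only [tokens, Finset.sum_add_distrib]
  rw [Finset.sum_sum_eq_sum_biUnion_of_unique L _
      fun A hA S hS e h h' => hlam.eq_of_mem_inDelta_sdiff hA hS h h',
    Finset.sum_sum_eq_sum_biUnion_of_unique L _
      fun A hA S hS e h h' => hlam.eq_of_mem_childDelta_sdiff hA hS h h']
  obtain ⟨M, hM⟩ := L.exists_maximal hL
  obtain ⟨e, he⟩ := hne M hM.prop
  have heB : e ∉ L.biUnion fun A => childDelta tail head L A \ inDelta tail head A := by
    rw [Finset.mem_biUnion]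
    rintro ⟨A, hA, heA⟩
    exact hlam.notMem_childDelta_sdiff_of_maximal hM hA he heA
  have hsub : ∑ e ∈ L.biUnion (fun A => inDelta tail head A \ childDelta tail head L A), y e
      ≤ ∑ e, y e :=
    Finset.sum_le_univ_sum_of_nonneg fun e => (hy0 e).le
  have hlt : ∑ e ∈ L.biUnion (fun A => childDelta tail head L A \ inDelta tail head A),
      (1 - y e) < ∑ e, (1 - y e) :=
    Finset.sum_lt_sum_of_subset (Finset.subset_univ _) (Finset.mem_univ e) heB
      (sub_pos.2 (hy1 e)) fun e _ _ => (sub_pos.2 (hy1 e)).le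
  have hcard : ∑ e, y e + ∑ e, (1 - y e) = Fintype.card E := by
    simp
  linarith

end Entering

theorem stmt_7 {V E : Type*} [Fintype V] [DecidableEq V] [Fintype E] [Nonempty E]
    (tail head : E → V) (B : Finset V) (b : V → ℕ)
    (f : Biset V → ℤ) (α : ℤ) (hα : 2 ≤ α)
    (x : E → ℝ) (hx : x ∈ dirP tail head f B b)
    (hx01 : ∀ e : E, 0 < x e ∧ x e < 1)
    (L : Finset (Biset V)) (C : Finset V)
    (hlam : Biset.Laminar L) (hCB : C ⊆ B)
    (hcard : L.card + C.card = Fintype.card E)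
    (htight : ∀ A ∈ L, (∑ e ∈ inDelta tail head A, x e) = (f A : ℝ) ∧ 1 ≤ f A)
    (hdeg : ∀ v ∈ C, (∑ e ∈ outDeg tail head v, x e) = (b v : ℝ))
    (hind : LinearIndependent ℝ (Sum.elim
      (fun A : {A // A ∈ L} => incVec (inDelta tail head A.1))
      (fun v : {v // v ∈ C} => incVec (outDeg tail head v.1))))
    (hEC : (C.card : ℤ) ≤ (α - 1) * ((leaves L).card : ℤ)) :
    ∃ e : E, 1 / (α : ℝ) ≤ x e := by
  by_contra! hlt
  have hα0 : (0 : ℝ) < α := by exact_mod_cast (by omega : (0 : ℤ) < α)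
  set y : E → ℝ := fun e => α * x e with hy
  have hy0 : ∀ e, 0 < y e := fun e => mul_pos hα0 (hx01 e).1
  have hy1 : ∀ e, y e < 1 := fun e => by
    have := (lt_div_iff₀ hα0).1 (hlt e)
    simpa [hy, mul_comm] using this
  have hL : L.Nonempty := by
    rw [Finset.nonempty_iff_ne_empty]
    rintro rfl
    have hpos := Fintype.card_pos (α := E)
    simp only [leaves, Finset.filter_empty, Finset.card_empty, Nat.cast_zero, mul_zero] at hEC
    simp only [Finset.card_empty] at hcard
    omega
  have hne : ∀ A ∈ L, (inDelta tail head A).Nonempty := fun A hA => by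
    rw [Finset.nonempty_iff_ne_empty]
    intro h0
    obtain ⟨h1, h2⟩ := htight A hA
    rw [h0, Finset.sum_empty] at h1
    have : f A = 0 := by exact_mod_cast h1.symm
    omega
  have hindL : LinearIndependent ℝ
      fun A : {A // A ∈ L} => incVec (inDelta tail head A.1) :=
    hind.comp Sum.inl Sum.inl_injective
  have hysum : ∀ A ∈ L, ∑ e ∈ inDelta tail head A, y e = ((α * f A : ℤ) : ℝ) := fun A hA => by
    rw [hy, ← Finset.mul_sum, (htight A hA).1, Int.cast_mul]
  have hge1 : ∀ A ∈ L, 1 ≤ tokens tail head L y A := fun A hA => by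
    have hpos := tokens_pos (L := L) hy0 hy1 (hlam.inDelta_ne_childDelta hindL hA)
    rw [hlam.tokens_eq, hysum A hA, Finset.sum_congr rfl
      fun R hR => hysum R (Biset.mem_children.1 hR).prop.1] at hpos ⊢
    exact_mod_cast hpos
  have hgeα : ∀ A ∈ leaves L, (α : ℝ) ≤ tokens tail head L y A := fun A hA => by
    have hAL := leaves_subset L hA
    rw [hlam.tokens_eq, children_eq_empty_of_mem_leaves hA, Finset.sum_empty, hysum A hAL]
    have : α ≤ α * f A := le_mul_of_one_le_right (by omega) (htight A hAL).2
    have : (α : ℝ) ≤ ((α * f A : ℤ) : ℝ) := by exact_mod_cast this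
    have := Nat.cast_nonneg (α := ℝ) (childDelta tail head L A \ inDelta tail head A).card
    linarith
  have htot : ∑ A ∈ L, (1 + if A ∈ leaves L then (α : ℝ) - 1 else 0)
      ≤ ∑ A ∈ L, tokens tail head L y A := Finset.sum_le_sum fun A hA => by
    split_ifs with h
    · linarith [hgeα A h]
    · linarith [hge1 A hA]
  have hleaf : L ∩ leaves L = leaves L := Finset.inter_eq_right.2 (leaves_subset L)
  rw [Finset.sum_add_distrib, Finset.sum_ite_mem, hleaf] at htot
  simp only [Finset.sum_const, nsmul_eq_mul, mul_one] at htot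
  have hfin := hlam.sum_tokens_lt hy0 hy1 hL hne
  have hcard' : (L.card : ℝ) + C.card = Fintype.card E := by exact_mod_cast hcard
  have hEC' : (C.card : ℝ) ≤ (α - 1) * (leaves L).card := by exact_mod_cast hEC
  linarith
end
end

section
/- Let V be a finite set, E a nonempty finite set of undirected edges on V, B ⊆ V, b : B → ℤ≥0, f an integer-valued biset function on V, and α ≥ 4 an integer. Let x ∈ P(f,b,E) with 0 < x(e) < 1 for all e ∈ E, and suppose there exist a strongly laminar biset family L on V and C ⊆ B such that |L| + |C| = |E|, x(δ_E(Ŝ)) = f(Ŝ) ≥ 1 for all Ŝ ∈ L, x(δ_E(v)) = b(v) for all v ∈ C, and the incidence vectors in ℝ^E of the sets δ_E(Ŝ) for Ŝ ∈ L together with those of δ_E(v) for v ∈ C are linearly independent. Let 𝓔 be the set of leaves of L and γ = max_{Ŝ∈L} |Γ(Ŝ)| (γ = 0 if L is empty). If |C| > (α/2 − 1)|𝓔|, then there is an edge e ∈ E with x(e) ≥ 1/α, or there is a node v ∈ C with |δ_E(v)| ≤ ⌈4(γ+2)/(α−2)⌉ + 5. -/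
noncomputable section

attribute [local instance] Classical.propDecidable

section Undirected

variable {V E : Type*} [Fintype V] [DecidableEq V] [Fintype E]

/-- `δ_E(Ŝ)`: undirected edges covering the biset
(one end-node in the inner part, the other outside the outer part). -/
def uDelta (ep1 ep2 : E → V) (A : Biset V) : Finset E :=
  Finset.univ.filter fun e =>
    (ep1 e ∈ A.inner ∧ ep2 e ∉ A.outer) ∨ (ep2 e ∈ A.inner ∧ ep1 e ∉ A.outer)

/-- `δ_E(v) = δ_E(({v},{v}))`. -/
def uDeg (ep1 ep2 : E → V) (v : V) : Finset E :=
  uDelta ep1 ep2 (Biset.vertexBiset v)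

/-- The polytope `P(f,b,E)` for undirected edges. -/
def undirP (ep1 ep2 : E → V) (f : Biset V → ℤ) (B : Finset V) (b : V → ℕ) :
    Set (E → ℝ) :=
  {x | (∀ e : E, 0 ≤ x e ∧ x e ≤ 1) ∧
       (∀ A : Biset V, (f A : ℝ) ≤ ∑ e ∈ uDelta ep1 ep2 A, x e) ∧
       (∀ v ∈ B, ∑ e ∈ uDeg ep1 ep2 v, x e ≤ (b v : ℝ))}

end Undirected

namespace Biset

variable {V : Type*}

/-- Bisets are partially ordered by containment. -/
instance : PartialOrder (Biset V) where
  le := Sub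
  le_refl A := ⟨Finset.Subset.refl _, Finset.Subset.refl _⟩
  le_trans A B D h k := ⟨h.1.trans k.1, h.2.trans k.2⟩
  le_antisymm A B h k := by
    cases A; cases B
    obtain rfl := Finset.Subset.antisymm h.1 k.1
    obtain rfl := Finset.Subset.antisymm h.2 k.2
    rfl

theorem inner_subset {A B : Biset V} (h : A ≤ B) : A.inner ⊆ B.inner := h.1

theorem outer_subset {A B : Biset V} (h : A ≤ B) : A.outer ⊆ B.outer := h.2

theorem mem_leaves {L : Finset (Biset V)} {A : Biset V} :
    A ∈ leaves L ↔ A ∈ L ∧ ∀ B ∈ L, B ≤ A → B = A := by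
  unfold leaves
  rw [Finset.mem_filter]
  rfl

/-- `S` is the largest member of `L` strictly below `T`. -/
def IsOnlyChild (L : Finset (Biset V)) (S T : Biset V) : Prop :=
  S ∈ L ∧ S < T ∧ ∀ U ∈ L, U < T → U ≤ S

/-- A choice of a leaf below every member of `L`, hereditary in the sense that the leaf chosen for
`U` is also chosen for every `T ≤ U` above that leaf. -/
structure IsLeafSelector (L : Finset (Biset V)) (sel : Biset V → Biset V) : Prop where
  mem : ∀ T ∈ L, sel T ∈ leaves L
  le : ∀ T ∈ L, sel T ≤ T
  hereditary : ∀ T ∈ L, ∀ U ∈ L, T ≤ U → sel U ≤ T → sel T = sel U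

theorem exists_isLeafSelector [Fintype V] (L : Finset (Biset V)) :
    ∃ sel, IsLeafSelector L sel := by
  let r := Fintype.equivFin (Biset V)
  have key : ∀ T : Biset V, ∃ A : Biset V, T ∈ L →
      (A ∈ leaves L ∧ A ≤ T) ∧ ∀ B ∈ leaves L, B ≤ T → r A ≤ r B := by
    intro T
    by_cases hT : T ∈ L
    · obtain ⟨M, hMT, hM⟩ := L.exists_le_minimal hT
      have hMl : M ∈ leaves L :=
        mem_leaves.2 ⟨hM.prop, fun B hB hBM => le_antisymm hBM (hM.le_of_le hB hBM)⟩
      obtain ⟨A, hA, hmin⟩ := ((leaves L).filter (· ≤ T)).exists_min_image r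
        ⟨M, Finset.mem_filter.2 ⟨hMl, hMT⟩⟩
      exact ⟨A, fun _ => ⟨Finset.mem_filter.1 hA,
        fun B hB hBT => hmin B (Finset.mem_filter.2 ⟨hB, hBT⟩)⟩⟩
    · exact ⟨T, fun h => absurd h hT⟩
  choose sel hsel using key
  refine ⟨sel, fun T hT => (hsel T hT).1.1, fun T hT => (hsel T hT).1.2, ?_⟩
  intro T hT U hU hTU h
  exact r.injective (le_antisymm ((hsel T hT).2 _ (hsel U hU).1.1 h)
    ((hsel U hU).2 _ (hsel T hT).1.1 ((hsel T hT).1.2.trans hTU)))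

variable [DecidableEq V]

theorem StronglyLaminar.le_or_le {L : Finset (Biset V)} (hL : StronglyLaminar L)
    {A B : Biset V} (hA : A ∈ L) (hB : B ∈ L) {p : V} (hpA : p ∈ A.inner) (hpB : p ∈ B.outer) :
    A ≤ B ∨ B ≤ A := by
  rcases hL A hA B hB with h | h | h
  · exact Or.inl h
  · exact Or.inr h
  · exact absurd (Finset.mem_inter.2 ⟨hpA, hpB⟩) (by rw [h.1]; exact Finset.notMem_empty p)

theorem StronglyLaminar.le_or_le_of_leaf {L : Finset (Biset V)} (hL : StronglyLaminar L)
    (hne : ∀ A ∈ L, A.inner.Nonempty) {A T U : Biset V} (hA : A ∈ leaves L)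
    (hT : T ∈ L) (hU : U ∈ L) (hAT : A ≤ T) (hAU : A ≤ U) : T ≤ U ∨ U ≤ T := by
  obtain ⟨p, hp⟩ := hne A (mem_leaves.1 hA).1
  exact hL.le_or_le hT hU (inner_subset hAT hp) (U.subset (inner_subset hAU hp))

/-- Every non-leaf without an only child has a maximal proper member with a different selected
leaf. -/
theorem exists_child_sel_ne {L : Finset (Biset V)} (hL : StronglyLaminar L)
    (hne : ∀ A ∈ L, A.inner.Nonempty) {sel : Biset V → Biset V} (hsel : IsLeafSelector L sel)
    {T : Biset V} (hT : T ∈ L) (hleaf : T ∉ leaves L) (hch : ¬ ∃ S, IsOnlyChild L S T) :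
    ∃ S ∈ L, S < T ∧ (∀ U ∈ L, U < T → S ≤ U → U = S) ∧ sel S ≠ sel T := by
  have hlt : sel T < T := lt_of_le_of_ne (hsel.le T hT) fun h => hleaf (h ▸ hsel.mem T hT)
  have hexm : ∀ A ∈ L, A < T → ∃ S ∈ L, S < T ∧ A ≤ S ∧ ∀ U ∈ L, U < T → S ≤ U → U = S := by
    intro A hA hAT
    obtain ⟨S, hAS, hS⟩ := (L.filter (· < T)).exists_le_maximal
      (Finset.mem_filter.2 ⟨hA, hAT⟩)
    have hS' := Finset.mem_filter.1 hS.prop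
    exact ⟨S, hS'.1, hS'.2, hAS, fun U hU hUT h =>
      le_antisymm (hS.le_of_ge (Finset.mem_filter.2 ⟨hU, hUT⟩) h) h⟩
  obtain ⟨S₀, hS₀, hS₀T, hsS₀, hmax₀⟩ := hexm _ (mem_leaves.1 (hsel.mem T hT)).1 hlt
  have : ∃ U ∈ L, U < T ∧ ¬ U ≤ S₀ := by
    by_contra! h
    exact hch ⟨S₀, hS₀, hS₀T, h⟩
  obtain ⟨U, hU, hUT, hUS⟩ := this
  obtain ⟨S, hS, hST, hUS', hmax⟩ := hexm U hU hUT
  refine ⟨S, hS, hST, hmax, fun heq => hUS ?_⟩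
  rcases hL.le_or_le_of_leaf hne (hsel.mem T hT) hS hS₀ (heq ▸ hsel.le S hS) hsS₀ with h | h
  · exact hUS'.trans h
  · exact hUS'.trans (hmax₀ S hS hST h).le

theorem card_branching_le [Fintype V] {L : Finset (Biset V)} (hL : StronglyLaminar L)
    (hne : ∀ A ∈ L, A.inner.Nonempty) {sel : Biset V → Biset V} (hsel : IsLeafSelector L sel) :
    (L.filter fun T => T ∉ leaves L ∧ ¬ ∃ S, IsOnlyChild L S T).card ≤ (leaves L).card := by
  have key : ∀ T : Biset V, ∃ S, T ∈ L → T ∉ leaves L → (¬ ∃ S, IsOnlyChild L S T) →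
      S ∈ L ∧ S < T ∧ (∀ U ∈ L, U < T → S ≤ U → U = S) ∧ sel S ≠ sel T := by
    intro T
    by_cases h : T ∈ L ∧ T ∉ leaves L ∧ ¬ ∃ S, IsOnlyChild L S T
    · obtain ⟨S, hS⟩ := exists_child_sel_ne hL hne hsel h.1 h.2.1 h.2.2
      exact ⟨S, fun _ _ _ => hS⟩
    · exact ⟨T, fun h₁ h₂ h₃ => absurd ⟨h₁, h₂, h₃⟩ h⟩
  choose c hc using key
  have hc' : ∀ T ∈ L.filter fun T => T ∉ leaves L ∧ ¬ ∃ S, IsOnlyChild L S T,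
      T ∈ L ∧ c T ∈ L ∧ c T < T ∧ (∀ U ∈ L, U < T → c T ≤ U → U = c T) ∧
        sel (c T) ≠ sel T := by
    intro T hT
    obtain ⟨h₁, h₂, h₃⟩ := Finset.mem_filter.1 hT
    exact ⟨h₁, hc T h₁ h₂ h₃⟩
  have not_lt : ∀ T ∈ L.filter fun T => T ∉ leaves L ∧ ¬ ∃ S, IsOnlyChild L S T,
      ∀ U ∈ L.filter fun T => T ∉ leaves L ∧ ¬ ∃ S, IsOnlyChild L S T,
      sel (c T) = sel (c U) → ¬ T < U := by
    intro T hT U hU heq hlt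
    obtain ⟨hTL, hcT, hcTT, -, hneT⟩ := hc' T hT
    obtain ⟨hUL, hcU, hcUU, hmax, -⟩ := hc' U hU
    have hle : sel (c U) ≤ T := heq ▸ (hsel.le _ hcT).trans hcTT.le
    have hTc : T ≤ c U := by
      rcases hL.le_or_le_of_leaf hne (hsel.mem _ hcU) hTL hcU hle (hsel.le _ hcU) with h | h
      · exact h
      · exact (hmax T hTL hlt h).le
    exact hneT (heq.trans (hsel.hereditary T hTL _ hcU hTc hle).symm)
  refine Finset.card_le_card_of_injOn (fun T => sel (c T))
    (fun T hT => hsel.mem _ (hc' T hT).2.1) ?_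
  intro T hT U hU heq
  simp only at heq
  obtain ⟨hTL, hcT, hcTT, -, -⟩ := hc' T hT
  obtain ⟨hUL, hcU, hcUU, -, -⟩ := hc' U hU
  have hle : sel (c U) ≤ T := heq ▸ (hsel.le _ hcT).trans hcTT.le
  rcases hL.le_or_le_of_leaf hne (hsel.mem _ hcU) hTL hUL hle
    ((hsel.le _ hcU).trans hcUU.le) with h | h
  · exact h.eq_of_not_lt (not_lt T hT U hU heq)
  · exact (h.eq_of_not_lt (not_lt U hU T hT heq.symm)).symm

theorem card_le_of_only_child_add_leaves [Fintype V] {L : Finset (Biset V)}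
    (hL : StronglyLaminar L) (hne : ∀ A ∈ L, A.inner.Nonempty) :
    L.card ≤ (L.filter fun T => ∃ S, IsOnlyChild L S T).card + 2 * (leaves L).card := by
  obtain ⟨sel, hsel⟩ := exists_isLeafSelector L
  have h := card_branching_le hL hne hsel
  have hsub : L ⊆ ((L.filter fun T => ∃ S, IsOnlyChild L S T) ∪ leaves L) ∪
      (L.filter fun T => T ∉ leaves L ∧ ¬ ∃ S, IsOnlyChild L S T) := by
    intro T hT
    by_cases h₁ : T ∈ leaves L
    · exact Finset.mem_union_left _ (Finset.mem_union_right _ h₁)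
    · by_cases h₂ : ∃ S, IsOnlyChild L S T
      · exact Finset.mem_union_left _
          (Finset.mem_union_left _ (Finset.mem_filter.2 ⟨hT, h₂⟩))
      · exact Finset.mem_union_right _ (Finset.mem_filter.2 ⟨hT, h₁, h₂⟩)
  have h₁ := Finset.card_le_card hsub
  have h₂ := Finset.card_union_le ((L.filter fun T => ∃ S, IsOnlyChild L S T) ∪ leaves L)
    (L.filter fun T => T ∉ leaves L ∧ ¬ ∃ S, IsOnlyChild L S T)
  have h₃ := Finset.card_union_le (L.filter fun T => ∃ S, IsOnlyChild L S T) (leaves L)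
  omega

/-- Few members of `L` have a node of `C` in the inner part that is new relative to the only
child. -/
theorem card_inner_new_le {L N : Finset (Biset V)} (hL : StronglyLaminar L) {C : Finset V}
    (hN : ∀ T ∈ N, T ∈ L ∧ ∃ S, IsOnlyChild L S T ∧ ∃ v ∈ C, v ∈ T.inner ∧ v ∉ S.inner) :
    N.card ≤ C.card := by
  rcases N.eq_empty_or_nonempty with h₀ | ⟨T₀, hT₀⟩
  · simp [h₀]
  obtain ⟨-, -, -, v₀, -⟩ := hN T₀ hT₀
  have : Nonempty V := ⟨v₀⟩
  have key : ∀ T ∈ N, ∃ v ∈ C, ∃ S, IsOnlyChild L S T ∧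
      v ∈ T.inner ∧ v ∉ S.inner := by
    intro T h
    obtain ⟨-, S, hS, v, hv, hvT⟩ := hN T h
    exact ⟨v, hv, S, hS, hvT⟩
  choose! v hv s hs using key
  refine Finset.card_le_card_of_injOn v hv ?_
  have not_lt : ∀ T ∈ N, ∀ U ∈ N, v T = v U → ¬ T < U := by
    intro T hT U hU heq hlt
    exact (hs U hU).2.2 (inner_subset ((hs U hU).1.2.2 T (hN T hT).1 hlt)
      (heq ▸ (hs T hT).2.1))
  intro T hT U hU heq
  rcases hL.le_or_le (hN T hT).1 (hN U hU).1 (hs T hT).2.1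
    (U.subset (heq ▸ (hs U hU).2.1)) with h | h
  · exact h.eq_of_not_lt (not_lt T hT U hU heq)
  · exact (h.eq_of_not_lt (not_lt U hU T hT heq.symm)).symm

/-- A bound on the number of members of `L` having a node of `C` in the boundary that is new
relative to the outer part of the only child. -/
theorem card_boundary_new_le [Fintype V] {L N : Finset (Biset V)} (hL : StronglyLaminar L)
    (hne : ∀ A ∈ L, A.inner.Nonempty) {C : Finset V}
    (hN : ∀ T ∈ N, T ∈ L ∧ ∃ S, IsOnlyChild L S T ∧
      ∃ v ∈ C, v ∈ T.outer ∧ v ∉ T.inner ∧ v ∉ S.outer) :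
    N.card ≤ C.card + gammaL L * (leaves L).card := by
  obtain ⟨sel, hsel⟩ := exists_isLeafSelector L
  rcases N.eq_empty_or_nonempty with h₀ | ⟨T₀, hT₀⟩
  · simp [h₀]
  obtain ⟨-, -, -, v₀, -⟩ := hN T₀ hT₀
  have : Nonempty V := ⟨v₀⟩
  have key : ∀ T ∈ N, ∃ v ∈ C, ∃ S, IsOnlyChild L S T ∧
      v ∈ T.outer ∧ v ∉ T.inner ∧ v ∉ S.outer := by
    intro T h
    obtain ⟨-, S, hS, v, hv, hvT⟩ := hN T h
    exact ⟨v, hv, S, hS, hvT⟩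
  choose! v hv s hs using key
  have not_lt : ∀ T ∈ N, ∀ U ∈ N, v T = v U → ¬ T < U := by
    intro T hT U hU heq hlt
    exact (hs U hU).2.2.2 (outer_subset ((hs U hU).1.2.2 T (hN T hT).1 hlt)
      (heq ▸ (hs T hT).2.1))
  have comparable : ∀ T ∈ N, ∀ U ∈ N, sel T = sel U → T ≤ U ∨ U ≤ T := fun T hT U hU h =>
    hL.le_or_le_of_leaf hne (hsel.mem T (hN T hT).1) (hN T hT).1 (hN U hU).1
      (hsel.le T (hN T hT).1) (h ▸ hsel.le U (hN U hU).1)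
  have inj : ∀ T ∈ N, ∀ U ∈ N, sel T = sel U → v T = v U → T = U := by
    intro T hT U hU hs' heq
    rcases comparable T hT U hU hs' with h | h
    · exact h.eq_of_not_lt (not_lt T hT U hU heq)
    · exact (h.eq_of_not_lt (not_lt U hU T hT heq.symm)).symm
  let p : Biset V → Prop := fun T => ∃ U ∈ L, T ≤ U ∧ sel U = sel T ∧ v T ∈ U.inner
  have absorbed : (N.filter p).card ≤ C.card := by
    refine Finset.card_le_card_of_injOn v (fun T hT => hv T (Finset.mem_filter.1 hT).1) ?_
    intro T hT T' hT' heq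
    obtain ⟨hTN, U, hU, hTU, hUs, hvU⟩ := Finset.mem_filter.1 hT
    obtain ⟨hTN', U', hU', hTU', hUs', hvU'⟩ := Finset.mem_filter.1 hT'
    refine inj T hTN T' hTN' ?_ heq
    have hTL := (hN T hTN).1
    have hTL' := (hN T' hTN').1
    have h₁ : T ≤ U' := by
      rw [← heq] at hvU'
      rcases hL.le_or_le hU' hTL hvU' (hs T hTN).2.1 with h | h
      · exact absurd (inner_subset h hvU') (hs T hTN).2.2.1
      · exact h
    have h₂ : T' ≤ U := by
      rw [heq] at hvU
      rcases hL.le_or_le hU hTL' hvU (hs T' hTN').2.1 with h | h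
      · exact absurd (inner_subset h hvU) (hs T' hTN').2.2.1
      · exact h
    rcases hL.le_or_le hU hU' hvU (U'.subset (heq ▸ hvU')) with h | h
    · rw [← hUs, ← hUs']
      exact hsel.hereditary U hU U' hU' h (hUs' ▸ (hsel.le T' hTL').trans h₂)
    · rw [← hUs, ← hUs']
      exact (hsel.hereditary U' hU' U hU h (hUs ▸ (hsel.le T hTL).trans h₁)).symm
  have remaining : (N.filter fun T => ¬ p T).card ≤ gammaL L * (leaves L).card := by
    refine Finset.card_le_mul_card_image_of_maps_to
      (fun T hT => hsel.mem T (hN T (Finset.mem_filter.1 hT).1).1) _ fun A hA => ?_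
    rcases Finset.eq_empty_or_nonempty ((N.filter fun T => ¬ p T).filter fun T => sel T = A)
      with h | h
    · rw [h]; simp
    · obtain ⟨U, hU⟩ := Finset.exists_maximal h
      obtain ⟨hU₁, hUA⟩ := Finset.mem_filter.1 hU.prop
      have hUN := (Finset.mem_filter.1 hU₁).1
      refine le_trans (Finset.card_le_card_of_injOn (t := boundary U) v ?_ ?_)
        (Finset.le_sup (f := fun A => (boundary A).card) (hN U hUN).1)
      · intro T hT
        obtain ⟨hT₁, hTA⟩ := Finset.mem_filter.1 hT
        obtain ⟨hTN, hTp⟩ := Finset.mem_filter.1 hT₁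
        have hTU : T ≤ U := by
          rcases comparable T hTN U hUN (hTA.trans hUA.symm) with h | h
          · exact h
          · exact hU.le_of_ge hT h
        exact Finset.mem_sdiff.2 ⟨outer_subset hTU (hs T hTN).2.1,
          fun hin => hTp ⟨U, (hN U hUN).1, hTU, hUA.trans hTA.symm, hin⟩⟩
      · intro T hT T' hT' heq
        obtain ⟨hT₁, hTA⟩ := Finset.mem_filter.1 hT
        obtain ⟨hT₁', hTA'⟩ := Finset.mem_filter.1 hT'
        exact inj T (Finset.mem_filter.1 hT₁).1 T' (Finset.mem_filter.1 hT₁').1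
          (hTA.trans hTA'.symm) heq
  have := Finset.card_filter_add_card_filter_not (s := N) p
  omega

end Biset

/-- If two different finite sets have total weights differing by an integer, and all weights lie
strictly between `0` and `1`, then the sets differ in at least two elements. -/
theorem two_le_card_symmDiff {ι : Type*} [DecidableEq ι] {x : ι → ℝ}
    (hx : ∀ e, 0 < x e ∧ x e < 1) {F G : Finset ι}
    (hFG : F ≠ G) {k l : ℤ} (hF : ∑ e ∈ F, x e = k) (hG : ∑ e ∈ G, x e = l) :
    2 ≤ (symmDiff F G).card := by
  by_contra! hlt
  have hpos : 0 < (symmDiff F G).card := by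
    rw [Finset.card_pos]
    by_contra h
    rw [Finset.not_nonempty_iff_eq_empty] at h
    exact hFG (symmDiff_eq_bot.1 h)
  have key : ∀ {F G : Finset ι} {k l : ℤ}, ∑ e ∈ F, x e = k → ∑ e ∈ G, x e = l →
      ∀ e, F \ G = {e} → G \ F = ∅ → False := by
    intro F G k l hF hG e h₁ h₂
    have h := Finset.sum_sdiff_sub_sum_sdiff (s₁ := G) (s₂ := F) (f := x)
    rw [h₁, h₂, Finset.sum_singleton, Finset.sum_empty, hF, hG, sub_zero] at h
    have h0 := (hx e).1
    have h1 := (hx e).2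
    rw [h] at h0 h1
    norm_cast at h0 h1
    omega
  have hcard : (F \ G).card + (G \ F).card = 1 := by
    rw [← Finset.card_union_of_disjoint disjoint_sdiff_sdiff]
    have : F \ G ∪ G \ F = symmDiff F G := rfl
    rw [this]
    omega
  rcases Nat.add_eq_one_iff.1 hcard with ⟨h₁, h₂⟩ | ⟨h₁, h₂⟩
  · obtain ⟨e, he⟩ := Finset.card_eq_one.1 h₂
    exact key hG hF e he (Finset.card_eq_zero.1 h₁)
  · obtain ⟨e, he⟩ := Finset.card_eq_one.1 h₁
    exact key hF hG e he (Finset.card_eq_zero.1 h₂)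

section EdgeEnds

open Biset

variable {V E : Type*}

/-- The node at an edge end; the ends of `e` are `(e, true)` and `(e, false)`. -/
def endNode (ep1 ep2 : E → V) (t : E × Bool) : V := cond t.2 (ep1 t.1) (ep2 t.1)

/-- The node at the opposite end of the edge. -/
def oppNode (ep1 ep2 : E → V) (t : E × Bool) : V := cond t.2 (ep2 t.1) (ep1 t.1)

variable [DecidableEq V] [Fintype E]

/-- The edge ends assigned to `T` with only child `S`. -/
def assignedEnds (ep1 ep2 : E → V) (S T : Biset V) : Finset (E × Bool) :=
  Finset.univ.filter fun t =>
    (endNode ep1 ep2 t ∈ T.inner ∧ endNode ep1 ep2 t ∉ S.inner ∧ oppNode ep1 ep2 t ∉ T.outer) ∨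
    (oppNode ep1 ep2 t ∈ S.inner ∧ endNode ep1 ep2 t ∈ T.outer ∧ endNode ep1 ep2 t ∉ S.outer)

theorem eq_of_mem_assignedEnds {ep1 ep2 : E → V} {L : Finset (Biset V)}
    (hL : StronglyLaminar L) {S T S' T' : Biset V} (hT : T ∈ L) (hT' : T' ∈ L)
    (hS : IsOnlyChild L S T) (hS' : IsOnlyChild L S' T') {t : E × Bool}
    (ht : t ∈ assignedEnds ep1 ep2 S T) (ht' : t ∈ assignedEnds ep1 ep2 S' T') : T = T' := by
  have key : ∀ {S T S' T' : Biset V}, T ∈ L → IsOnlyChild L S' T' →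
      t ∈ assignedEnds ep1 ep2 S T → t ∈ assignedEnds ep1 ep2 S' T' → ¬ T < T' ∨
        (oppNode ep1 ep2 t ∈ S.inner ∧ oppNode ep1 ep2 t ∉ T'.outer) := by
    intro S T S' T' hT hS' ht ht'
    by_cases hlt : T < T'
    · have hle := hS'.2.2 T hT hlt
      simp only [assignedEnds, Finset.mem_filter, Finset.mem_univ, true_and] at ht ht'
      rcases ht with ht | ht <;> rcases ht' with ht' | ht'
      · exact absurd (inner_subset hle ht.1) ht'.2.1
      · exact absurd (outer_subset hle (T.subset ht.1)) ht'.2.2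
      · exact Or.inr ⟨ht.1, ht'.2.2⟩
      · exact absurd (outer_subset hle ht.2.1) ht'.2.2
    · exact Or.inl hlt
  have not_lt : ∀ {S T S' T' : Biset V}, T ∈ L → IsOnlyChild L S T → IsOnlyChild L S' T' →
      t ∈ assignedEnds ep1 ep2 S T → t ∈ assignedEnds ep1 ep2 S' T' → ¬ T < T' := by
    intro S T S' T' hT hS hS' ht ht' hlt
    rcases key hT hS' ht ht' with h | h
    · exact h hlt
    · exact h.2 (T'.subset (inner_subset hlt.le (inner_subset hS.2.1.le h.1)))
  have comparable : T ≤ T' ∨ T' ≤ T := by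
    have ht₀ := ht
    have ht₀' := ht'
    simp only [assignedEnds, Finset.mem_filter, Finset.mem_univ, true_and] at ht₀ ht₀'
    rcases ht₀ with h | h <;> rcases ht₀' with h' | h'
    · exact hL.le_or_le hT hT' h.1 (T'.subset h'.1)
    · exact hL.le_or_le hT hT' h.1 h'.2.1
    · exact (hL.le_or_le hT' hT h'.1 h.2.1).symm
    · exact hL.le_or_le hT hT' (inner_subset hS.2.1.le h.1)
        (T'.subset (inner_subset hS'.2.1.le h'.1))
  rcases comparable with h | h
  · exact h.eq_of_not_lt (not_lt hT hS hS' ht ht')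
  · exact (h.eq_of_not_lt (not_lt hT' hS' hS ht' ht)).symm

theorem mem_uDelta {ep1 ep2 : E → V} {A : Biset V} {e : E} :
    e ∈ uDelta ep1 ep2 A ↔
      (ep1 e ∈ A.inner ∧ ep2 e ∉ A.outer) ∨ (ep2 e ∈ A.inner ∧ ep1 e ∉ A.outer) := by
  simp [uDelta]

theorem exists_end_mem_assignedEnds {ep1 ep2 : E → V} {S T : Biset V} (hST : S ≤ T) {e : E}
    (he : e ∈ symmDiff (uDelta ep1 ep2 S) (uDelta ep1 ep2 T)) :
    ∃ i, (e, i) ∈ assignedEnds ep1 ep2 S T := by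
  simp only [Finset.mem_symmDiff, mem_uDelta] at he
  rcases he with ⟨hS | hS, hT⟩ | ⟨hT | hT, hS⟩
  · exact ⟨false, Finset.mem_filter.2 ⟨Finset.mem_univ _, Or.inr ⟨hS.1,
      by_contra fun h => hT (Or.inl ⟨inner_subset hST hS.1, h⟩), hS.2⟩⟩⟩
  · exact ⟨true, Finset.mem_filter.2 ⟨Finset.mem_univ _, Or.inr ⟨hS.1,
      by_contra fun h => hT (Or.inr ⟨inner_subset hST hS.1, h⟩), hS.2⟩⟩⟩
  · exact ⟨true, Finset.mem_filter.2 ⟨Finset.mem_univ _, Or.inl ⟨hT.1,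
      fun h => hS (Or.inl ⟨h, fun k => hT.2 (outer_subset hST k)⟩), hT.2⟩⟩⟩
  · exact ⟨false, Finset.mem_filter.2 ⟨Finset.mem_univ _, Or.inl ⟨hT.1,
      fun h => hS (Or.inr ⟨h, fun k => hT.2 (outer_subset hST k)⟩), hT.2⟩⟩⟩

theorem two_le_card_assignedEnds {ep1 ep2 : E → V} {S T : Biset V} (hST : S ≤ T)
    (h : 2 ≤ (symmDiff (uDelta ep1 ep2 S) (uDelta ep1 ep2 T)).card) :
    2 ≤ (assignedEnds ep1 ep2 S T).card := by
  refine h.trans ((Finset.card_le_card fun e he => ?_).trans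
    (Finset.card_image_le (s := assignedEnds ep1 ep2 S T) (f := Prod.fst)))
  obtain ⟨i, hi⟩ := exists_end_mem_assignedEnds hST he
  exact Finset.mem_image.2 ⟨(e, i), hi, rfl⟩

theorem card_uDeg_le (ep1 ep2 : E → V) (v : V) :
    (uDeg ep1 ep2 v).card ≤
      (Finset.univ.filter fun t : E × Bool => endNode ep1 ep2 t = v).card := by
  refine (Finset.card_le_card fun e he => ?_).trans
    (Finset.card_image_le (f := Prod.fst))
  simp only [uDeg, mem_uDelta, vertexBiset, Finset.mem_singleton] at he
  rcases he with he | he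
  · exact Finset.mem_image.2 ⟨(e, true), Finset.mem_filter.2 ⟨Finset.mem_univ _, he.1⟩, rfl⟩
  · exact Finset.mem_image.2 ⟨(e, false), Finset.mem_filter.2 ⟨Finset.mem_univ _, he.1⟩, rfl⟩

theorem sum_card_uDeg_le (ep1 ep2 : E → V) (C : Finset V) :
    ∑ v ∈ C, (uDeg ep1 ep2 v).card ≤
      (Finset.univ.filter fun t : E × Bool => endNode ep1 ep2 t ∈ C).card := by
  have hmaps : Set.MapsTo (endNode ep1 ep2)
      (Finset.univ.filter fun t : E × Bool => endNode ep1 ep2 t ∈ C : Finset (E × Bool)) C :=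
    fun t ht => (Finset.mem_filter.1 ht).2
  rw [Finset.card_eq_sum_card_fiberwise hmaps]
  refine Finset.sum_le_sum fun v hv => (card_uDeg_le ep1 ep2 v).trans (Finset.card_le_card ?_)
  intro t ht
  have := (Finset.mem_filter.1 ht).2
  simp only [Finset.mem_filter, Finset.mem_univ, true_and]
  exact ⟨this ▸ hv, this⟩

/-- The edge-end count: members of a strongly laminar family and the degrees in `C` bound the
number of edges from below. -/
theorem sum_card_uDeg_add_card_le [Fintype V] {ep1 ep2 : E → V} {L : Finset (Biset V)}
    {C : Finset V}
    (hL : StronglyLaminar L) (hne : ∀ A ∈ L, A.inner.Nonempty)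
    (hdiff : ∀ S ∈ L, ∀ T ∈ L, S < T →
      2 ≤ (symmDiff (uDelta ep1 ep2 S) (uDelta ep1 ep2 T)).card) :
    ∑ v ∈ C, (uDeg ep1 ep2 v).card + 2 * L.card ≤
      2 * Fintype.card E + 4 * C.card + 2 * ((gammaL L + 2) * (leaves L).card) := by
  let N := L.filter fun T => ∃ S, IsOnlyChild L S T
  let N₁ := N.filter fun T => ∃ S, IsOnlyChild L S T ∧ ∃ v ∈ C, v ∈ T.inner ∧ v ∉ S.inner
  let N₂ := N.filter fun T => ∃ S, IsOnlyChild L S T ∧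
    ∃ v ∈ C, v ∈ T.outer ∧ v ∉ T.inner ∧ v ∉ S.outer
  have h₁ : N₁.card ≤ C.card := card_inner_new_le hL fun T hT =>
    ⟨(Finset.mem_filter.1 (Finset.mem_filter.1 hT).1).1, (Finset.mem_filter.1 hT).2⟩
  have h₂ : N₂.card ≤ C.card + gammaL L * (leaves L).card :=
    card_boundary_new_le hL hne fun T hT =>
      ⟨(Finset.mem_filter.1 (Finset.mem_filter.1 hT).1).1, (Finset.mem_filter.1 hT).2⟩
  let M := N \ (N₁ ∪ N₂)
  have hM : N.card ≤ M.card + (N₁.card + N₂.card) := by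
    have : N.card ≤ M.card + (N₁ ∪ N₂).card := Finset.card_le_card_sdiff_add_card
    have := Finset.card_union_le N₁ N₂
    omega
  have hNM : ∀ T ∈ M, T ∈ L ∧ ∃ S, IsOnlyChild L S T := fun T hT =>
    Finset.mem_filter.1 (Finset.mem_sdiff.1 hT).1
  have key : ∀ T ∈ M, ∃ S, IsOnlyChild L S T := fun T h => (hNM T h).2
  choose! s hs using key
  have hends : 2 * M.card ≤
      (Finset.univ.filter fun t : E × Bool => endNode ep1 ep2 t ∉ C).card := by
    have hdisj : (M : Set (Biset V)).PairwiseDisjoint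
        fun T => assignedEnds ep1 ep2 (s T) T := by
      intro T hT U hU hTU
      refine Finset.disjoint_left.2 fun t ht hu => hTU ?_
      exact eq_of_mem_assignedEnds hL (hNM T hT).1 (hNM U hU).1 (hs T hT) (hs U hU) ht hu
    calc 2 * M.card = ∑ T ∈ M, 2 := by rw [Finset.sum_const, smul_eq_mul, mul_comm]
      _ ≤ ∑ T ∈ M, (assignedEnds ep1 ep2 (s T) T).card := Finset.sum_le_sum fun T hT =>
          two_le_card_assignedEnds (hs T hT).2.1.le
            (hdiff _ (hs T hT).1 T (hNM T hT).1 (hs T hT).2.1)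
      _ = (M.biUnion fun T => assignedEnds ep1 ep2 (s T) T).card :=
          (Finset.card_biUnion hdisj).symm
      _ ≤ _ := Finset.card_le_card fun t ht => by
          obtain ⟨T, hT, htT⟩ := Finset.mem_biUnion.1 ht
          refine Finset.mem_filter.2 ⟨Finset.mem_univ _, fun htC => ?_⟩
          obtain ⟨hTN, hTn⟩ := Finset.mem_sdiff.1 hT
          rw [Finset.mem_union, not_or] at hTn
          have hn₁ := fun h => hTn.1 (Finset.mem_filter.2 ⟨hTN, s T, hs T hT, _, htC, h⟩)
          have hn₂ := fun h => hTn.2 (Finset.mem_filter.2 ⟨hTN, s T, hs T hT, _, htC, h⟩)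
          have hsub := @Biset.subset _ (s T) (endNode ep1 ep2 t)
          have htT' := (Finset.mem_filter.1 htT).2
          tauto
  have hdeg := sum_card_uDeg_le ep1 ep2 C
  have hall := Finset.card_filter_add_card_filter_not (s := (Finset.univ : Finset (E × Bool)))
    (fun t => endNode ep1 ep2 t ∈ C)
  rw [Finset.card_univ, Fintype.card_prod, Fintype.card_bool] at hall
  have hLN : L.card ≤ N.card + 2 * (leaves L).card := card_le_of_only_child_add_leaves hL hne
  rw [add_mul]
  omega

end EdgeEnds

theorem stmt_10 {V E : Type*} [Fintype V] [DecidableEq V] [Fintype E] [Nonempty E]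
    (ep1 ep2 : E → V) (B : Finset V) (b : V → ℕ)
    (f : Biset V → ℤ) (α : ℤ) (hα : 4 ≤ α)
    (x : E → ℝ) (hx : x ∈ undirP ep1 ep2 f B b)
    (hx01 : ∀ e : E, 0 < x e ∧ x e < 1)
    (L : Finset (Biset V)) (C : Finset V)
    (hlam : Biset.StronglyLaminar L) (hCB : C ⊆ B)
    (hcard : L.card + C.card = Fintype.card E)
    (htight : ∀ A ∈ L, (∑ e ∈ uDelta ep1 ep2 A, x e) = (f A : ℝ) ∧ 1 ≤ f A)
    (hdeg : ∀ v ∈ C, (∑ e ∈ uDeg ep1 ep2 v, x e) = (b v : ℝ))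
    (hind : LinearIndependent ℝ (Sum.elim
      (fun A : {A // A ∈ L} => incVec (uDelta ep1 ep2 A.1))
      (fun v : {v // v ∈ C} => incVec (uDeg ep1 ep2 v.1))))
    (hEC : ((α : ℝ) / 2 - 1) * ((leaves L).card : ℝ) < (C.card : ℝ)) :
    (∃ e : E, 1 / (α : ℝ) ≤ x e) ∨
    (∃ v ∈ C, ((uDeg ep1 ep2 v).card : ℤ) ≤
      ⌈(4 * ((gammaL L : ℝ) + 2)) / ((α : ℝ) - 2)⌉ + 5) := by
  right
  by_contra! hbig
  have hne : ∀ A ∈ L, A.inner.Nonempty := by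
    intro A hA
    by_contra h
    rw [Finset.not_nonempty_iff_eq_empty] at h
    have h0 : uDelta ep1 ep2 A = ∅ := by
      ext e
      simp [mem_uDelta, h]
    obtain ⟨hs, hf⟩ := htight A hA
    rw [h0, Finset.sum_empty] at hs
    have : f A = 0 := by exact_mod_cast hs.symm
    omega
  have hdiff : ∀ S ∈ L, ∀ T ∈ L, S < T →
      2 ≤ (symmDiff (uDelta ep1 ep2 S) (uDelta ep1 ep2 T)).card := by
    intro S hS T hT hST
    refine two_le_card_symmDiff hx01 (fun heq => hST.ne ?_) (htight S hS).1 (htight T hT).1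
    have := hind.injective (a₁ := Sum.inl ⟨S, hS⟩) (a₂ := Sum.inl ⟨T, hT⟩)
      (by simp only [Sum.elim_inl, heq])
    simpa using this
  have hcount := sum_card_uDeg_add_card_le (C := C) hlam hne hdiff
  set D : ℤ := ⌈(4 * ((gammaL L : ℝ) + 2)) / ((α : ℝ) - 2)⌉ with hD
  have hsum : (C.card : ℤ) * (D + 6) ≤ ∑ v ∈ C, ((uDeg ep1 ep2 v).card : ℤ) := by
    rw [← nsmul_eq_mul]
    exact Finset.card_nsmul_le_sum _ _ _ fun v hv => by have := hbig v hv; omega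
  zify at hcount hcard
  have hDC : (C.card : ℤ) * D ≤ 2 * (((gammaL L : ℤ) + 2) * (leaves L).card) := by linarith
  have hDC' : (C.card : ℝ) * D ≤ 2 * (((gammaL L : ℝ) + 2) * (leaves L).card) := by
    exact_mod_cast hDC
  have hα' : (0 : ℝ) < α - 2 := by
    have : (4 : ℝ) ≤ α := by exact_mod_cast hα
    linarith
  have hceil : 4 * ((gammaL L : ℝ) + 2) ≤ D * (α - 2) := (div_le_iff₀ hα').1 (Int.le_ceil _)
  have hγ : (0 : ℝ) < (gammaL L : ℝ) + 2 := by positivity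
  have hlt := mul_lt_mul_of_pos_left hEC (mul_pos (by norm_num : (0 : ℝ) < 4) hγ)
  have h₁ := mul_le_mul_of_nonneg_right hceil (Nat.cast_nonneg (α := ℝ) C.card)
  have h₂ := mul_le_mul_of_nonneg_right hDC' hα'.le
  nlinarith
end
end
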